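/- arXiv:2511.18022 — 7 statements merged into one kernel-verified Lean document; each statement's English description precedes it below -/
import Mathlib

section
/- The sample-average optimal value is strongly consistent: z_m* → z* almost surely as m → ∞, i.e. for P-almost every ω, min_{x∈X} (1/m) ∑_{i=1}^m f(x, ξ_i(ω)) converges to min_{x∈X} E_μ[f(x, ξ)]. -/
open MeasureTheory ProbabilityTheory Filter

/-- **Strong consistency of the sample-average optimal value.**
For `P`-almost every `ω`, `min_{x∈X} (1/m) ∑_{i<m} f(x, ξ_i(ω)) → min_{x∈X} E_μ[f(x, ξ)]`
as `m → ∞`. -/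
theorem saa_consistency
    {Ω : Type*} [MeasurableSpace Ω] (P : Measure Ω) [IsProbabilityMeasure P]
    {Ξ : Type*} [MeasurableSpace Ξ] (μ : Measure Ξ) [IsProbabilityMeasure μ]
    (ξ : ℕ → Ω → Ξ)
    (hmeas : ∀ i, Measurable (ξ i))
    (hdist : ∀ i, Measure.map (ξ i) P = μ)
    (hindep : iIndepFun ξ P)
    {X : Type*} [Fintype X] [Nonempty X]
    (f : X → Ξ → ℝ)
    (hfm : ∀ x, Measurable (f x))
    (hfi : ∀ x, Integrable (f x) μ) :
    ∀ᵐ ω ∂P, Tendsto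
      (fun m : ℕ => ⨅ x : X, (m : ℝ)⁻¹ * ∑ i ∈ Finset.range m, f x (ξ i ω))
      atTop (nhds (⨅ x : X, ∫ ξv, f x ξv ∂μ)) := by
  have key : ∀ x : X, ∀ᵐ ω ∂P, Tendsto
      (fun m : ℕ => (m : ℝ)⁻¹ * ∑ i ∈ Finset.range m, f x (ξ i ω))
      atTop (nhds (∫ ξv, f x ξv ∂μ)) := by
    intro x
    have hid : ∀ i, IdentDistrib (ξ i) (ξ 0) P P := fun i =>
      ⟨(hmeas i).aemeasurable, (hmeas 0).aemeasurable, by rw [hdist i, hdist 0]⟩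
    have hint : Integrable (fun ω => f x (ξ 0 ω)) P := by
      have h := hfi x
      rw [← hdist 0] at h
      exact h.comp_measurable (hmeas 0)
    have h := strong_law_ae (μ := P) (fun i ω => f x (ξ i ω)) hint
      (fun i j hij => (hindep.indepFun hij).comp (hfm x) (hfm x))
      (fun i => (hid i).comp (hfm x))
    have he : ∫ ω, f x (ξ 0 ω) ∂P = ∫ ξv, f x ξv ∂μ := by
      rw [← hdist 0]
      exact (integral_map (hmeas 0).aemeasurable (hfm x).aestronglyMeasurable).symm
    rw [← he]
    simpa only [smul_eq_mul] using h
  filter_upwards [ae_all_iff.2 key] with ω hω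
  simp only [← Finset.inf'_univ_eq_ciInf]
  exact Tendsto.finset_inf'_nhds_apply Finset.univ_nonempty (fun x _ => hω x)
end

section
/- Sample-average minimizers are eventually true minimizers: for P-almost every ω there exists M such that for all m ≥ M, every x ∈ X minimizing the sample-average x ↦ (1/m) ∑_{i=1}^m f(x, ξ_i(ω)) over X also minimizes x ↦ E_μ[f(x, ξ)] over X. -/
open MeasureTheory ProbabilityTheory Filter

/-- **Sample-average minimizers are eventually true minimizers.**
For `P`-almost every `ω` there exists `M` such that for all `m ≥ M`, every `x ∈ X`
minimizing the sample average `x ↦ (1/m) ∑_{i<m} f(x, ξ_i(ω))` over `X` also minimizes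
`x ↦ E_μ[f(x, ξ)]` over `X`. -/
theorem saa_minimizers_eventually_true
    {Ω : Type*} [MeasurableSpace Ω] (P : Measure Ω) [IsProbabilityMeasure P]
    {Ξ : Type*} [MeasurableSpace Ξ] (μ : Measure Ξ) [IsProbabilityMeasure μ]
    (ξ : ℕ → Ω → Ξ)
    (hmeas : ∀ i, Measurable (ξ i))
    (hdist : ∀ i, Measure.map (ξ i) P = μ)
    (hindep : iIndepFun ξ P)
    {X : Type*} [Fintype X] [Nonempty X]
    (f : X → Ξ → ℝ)
    (hfm : ∀ x, Measurable (f x))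
    (hfi : ∀ x, Integrable (f x) μ) :
    ∀ᵐ ω ∂P, ∃ M : ℕ, ∀ m ≥ M, ∀ x : X,
      (∀ y : X, (m : ℝ)⁻¹ * ∑ i ∈ Finset.range m, f x (ξ i ω)
          ≤ (m : ℝ)⁻¹ * ∑ i ∈ Finset.range m, f y (ξ i ω)) →
      (∀ y : X, ∫ ξv, f x ξv ∂μ ≤ ∫ ξv, f y ξv ∂μ) := by
  have key : ∀ x : X, ∀ᵐ ω ∂P, Tendsto
      (fun m : ℕ => (m : ℝ)⁻¹ * ∑ i ∈ Finset.range m, f x (ξ i ω)) atTop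
      (nhds (∫ v, f x v ∂μ)) := by
    intro x
    have hI : ∫ v, f x v ∂μ = ∫ ω, f x (ξ 0 ω) ∂P := by
      rw [← hdist 0]
      exact integral_map (hmeas 0).aemeasurable (hfm x).aestronglyMeasurable
    have hint : Integrable (fun ω => f x (ξ 0 ω)) P := by
      have h := hfi x
      rw [← hdist 0] at h
      exact h.comp_measurable (hmeas 0)
    rw [hI]
    have h := strong_law_ae (μ := P) (fun i ω => f x (ξ i ω)) hint
      (fun i j hij => (hindep.indepFun hij).comp (hfm x) (hfm x))
      (fun i => IdentDistrib.comp
        ⟨(hmeas i).aemeasurable, (hmeas 0).aemeasurable, by rw [hdist i, hdist 0]⟩ (hfm x))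
    simpa only [smul_eq_mul] using h
  filter_upwards [ae_all_iff.2 key] with ω hω
  have h : ∀ x y : X, ∀ᶠ m : ℕ in atTop,
      (m : ℝ)⁻¹ * ∑ i ∈ Finset.range m, f x (ξ i ω)
          ≤ (m : ℝ)⁻¹ * ∑ i ∈ Finset.range m, f y (ξ i ω) →
      ∫ v, f x v ∂μ ≤ ∫ v, f y v ∂μ := by
    intro x y
    rcases le_or_gt (∫ v, f x v ∂μ) (∫ v, f y v ∂μ) with hle | hlt
    · exact Eventually.of_forall fun _ _ => hle
    · filter_upwards [(hω y).eventually_lt (hω x) hlt] with m hm hm2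
      exact absurd hm2 (not_le.2 hm)
  obtain ⟨M, hM⟩ := eventually_atTop.1
    (eventually_all.2 fun x => eventually_all.2 fun y => h x y)
  exact ⟨M, fun m hm x hx y => hM m hm x y (hx y)⟩
end

section
/- Probabilistic convergence of the out-of-sample performance of the sample-average solution: let x_m* : Ω → X be any measurable selection such that x_m*(ω) minimizes x ↦ (1/m) ∑_{i=1}^m f(x, ξ_i(ω)) over X for each ω. Then for every ε > 0, P( { ω : E_μ[f(x_m*(ω), ξ)] ≤ z* + ε } ) → 1 as m → ∞. -/
open MeasureTheory ProbabilityTheory Filter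

/-- **Probabilistic convergence of out-of-sample performance of the SAA solution.**
If `x_m* : Ω → X` is a measurable selection of minimizers of the sample-average problem,
then for every `ε > 0`, `P( E_μ[f(x_m*(·), ξ)] ≤ z* + ε ) → 1` as `m → ∞`. -/
theorem saa_out_of_sample_convergence
    {Ω : Type*} [MeasurableSpace Ω] (P : Measure Ω) [IsProbabilityMeasure P]
    {Ξ : Type*} [MeasurableSpace Ξ] (μ : Measure Ξ) [IsProbabilityMeasure μ]
    (ξ : ℕ → Ω → Ξ)
    (hmeas : ∀ i, Measurable (ξ i))
    (hdist : ∀ i, Measure.map (ξ i) P = μ)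
    (hindep : iIndepFun ξ P)
    {X : Type*} [Fintype X] [Nonempty X]
    [MeasurableSpace X] [MeasurableSingletonClass X]
    (f : X → Ξ → ℝ)
    (hfm : ∀ x, Measurable (f x))
    (hfi : ∀ x, Integrable (f x) μ)
    (xsel : ℕ → Ω → X)
    (hsel_meas : ∀ m, Measurable (xsel m))
    (hsel_min : ∀ (m : ℕ) (ω : Ω), ∀ y : X,
      (m : ℝ)⁻¹ * ∑ i ∈ Finset.range m, f (xsel m ω) (ξ i ω)
        ≤ (m : ℝ)⁻¹ * ∑ i ∈ Finset.range m, f y (ξ i ω)) :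
    ∀ ε > (0 : ℝ), Tendsto
      (fun m : ℕ =>
        P {ω | ∫ ξv, f (xsel m ω) ξv ∂μ ≤ (⨅ x : X, ∫ ξv, f x ξv ∂μ) + ε})
      atTop (nhds 1) := by
  intro ε hε
  have hslln : ∀ x : X, ∀ᵐ ω ∂P, Tendsto
      (fun m : ℕ => (m : ℝ)⁻¹ * ∑ i ∈ Finset.range m, f x (ξ i ω)) atTop
      (nhds (∫ v, f x v ∂μ)) := by
    intro x
    have hi : ∫ v, f x v ∂μ = ∫ ω, f x (ξ 0 ω) ∂P := by
      rw [← hdist 0, integral_map (hmeas 0).aemeasurable (hfm x).aestronglyMeasurable]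
    have hint : Integrable (fun ω => f x (ξ 0 ω)) P := by
      have h := hfi x
      rw [← hdist 0] at h
      exact h.comp_measurable (hmeas 0)
    have h := strong_law_ae (μ := P) (fun i ω => f x (ξ i ω)) hint
      (fun i j hij => (hindep.indepFun hij).comp (hfm x) (hfm x))
      (fun i => (IdentDistrib.mk (hmeas i).aemeasurable (hmeas 0).aemeasurable
        ((hdist i).trans (hdist 0).symm)).comp (hfm x))
    rw [hi]
    simpa only [smul_eq_mul] using h
  obtain ⟨x0, hx0⟩ := exists_eq_ciInf_of_finite (f := fun x : X => ∫ v, f x v ∂μ)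
  have key := tendsto_measure_of_ae_tendsto_indicator_of_isFiniteMeasure (μ := P) atTop
    (A := Set.univ)
    (As := fun m : ℕ => {ω | ∫ ξv, f (xsel m ω) ξv ∂μ ≤ (⨅ x : X, ∫ ξv, f x ξv ∂μ) + ε})
    MeasurableSet.univ
    (fun m => hsel_meas m
      (Set.toFinite {x : X | ∫ ξv, f x ξv ∂μ ≤ (⨅ x : X, ∫ ξv, f x ξv ∂μ) + ε}).measurableSet)
    (by
      filter_upwards [ae_all_iff.2 hslln] with ω hω
      have h1 : ∀ᶠ m : ℕ in atTop, ∀ x : X,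
          |(m : ℝ)⁻¹ * ∑ i ∈ Finset.range m, f x (ξ i ω) - ∫ v, f x v ∂μ| < ε / 2 := by
        rw [eventually_all]
        intro x
        have := Metric.tendsto_nhds.1 (hω x) (ε / 2) (by positivity)
        simpa only [Real.dist_eq] using this
      filter_upwards [h1] with m hm
      simp only [Set.mem_setOf_eq, Set.mem_univ, iff_true]
      rw [← hx0]
      have a := abs_lt.1 (hm (xsel m ω))
      have b := abs_lt.1 (hm x0)
      have c := hsel_min m ω x0
      linarith [a.1, b.2])
  simpa only [measure_univ] using key
end

section
/- The sample-average optimal value converges to the true optimal value in probability: for every ε > 0, P( { ω : |z_m*(ω) − z*| > ε } ) → 0 as m → ∞. -/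
open MeasureTheory ProbabilityTheory Filter

/-- **Convergence in probability of the sample-average optimal value.**
For every `ε > 0`, `P( |z_m* − z*| > ε ) → 0` as `m → ∞`, where
`z_m*(ω) = min_{x∈X} (1/m) ∑_{i<m} f(x, ξ_i(ω))` and `z* = min_{x∈X} E_μ[f(x, ξ)]`. -/
theorem saa_value_convergence_in_probability
    {Ω : Type*} [MeasurableSpace Ω] (P : Measure Ω) [IsProbabilityMeasure P]
    {Ξ : Type*} [MeasurableSpace Ξ] (μ : Measure Ξ) [IsProbabilityMeasure μ]
    (ξ : ℕ → Ω → Ξ)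
    (hmeas : ∀ i, Measurable (ξ i))
    (hdist : ∀ i, Measure.map (ξ i) P = μ)
    (hindep : iIndepFun ξ P)
    {X : Type*} [Fintype X] [Nonempty X]
    (f : X → Ξ → ℝ)
    (hfm : ∀ x, Measurable (f x))
    (hfi : ∀ x, Integrable (f x) μ) :
    ∀ ε > (0 : ℝ), Tendsto
      (fun m : ℕ =>
        P {ω | ε < |(⨅ x : X, (m : ℝ)⁻¹ * ∑ i ∈ Finset.range m, f x (ξ i ω))
                      - ⨅ x : X, ∫ ξv, f x ξv ∂μ|})
      atTop (nhds 0) := by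
  have key : ∀ x, ∀ᵐ ω ∂P, Tendsto
      (fun m : ℕ => (m : ℝ)⁻¹ * ∑ i ∈ Finset.range m, f x (ξ i ω)) atTop
      (nhds (∫ v, f x v ∂μ)) := by
    intro x
    have h := strong_law_ae (μ := P) (fun i ω => f x (ξ i ω))
      (by
        have h0 := hfi x
        rw [← hdist 0] at h0
        exact h0.comp_measurable (hmeas 0))
      (fun i j hij => (hindep.indepFun hij).comp (hfm x) (hfm x))
      (fun i => IdentDistrib.comp
        ⟨(hmeas i).aemeasurable, (hmeas 0).aemeasurable, by rw [hdist, hdist]⟩ (hfm x))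
    have he : ∫ ω, f x (ξ 0 ω) ∂P = ∫ v, f x v ∂μ := by
      rw [← hdist 0, integral_map (hmeas 0).aemeasurable (hfm x).aestronglyMeasurable]
    rw [he] at h
    simpa only [smul_eq_mul] using h
  have hT : TendstoInMeasure P
      (fun (m : ℕ) ω => ⨅ x : X, (m : ℝ)⁻¹ * ∑ i ∈ Finset.range m, f x (ξ i ω)) atTop
      (fun _ => ⨅ x : X, ∫ v, f x v ∂μ) := by
    apply tendstoInMeasure_of_tendsto_ae
    · intro m
      refine (Measurable.iInf fun x => ?_).aestronglyMeasurable
      exact (Finset.measurable_sum _ fun i _ => (hfm x).comp (hmeas i)).const_mul _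
    · filter_upwards [ae_all_iff.2 key] with ω hω
      simp only [← Finset.inf'_univ_eq_ciInf]
      exact Tendsto.finset_inf'_nhds_apply Finset.univ_nonempty fun x _ => hω x
  intro ε hε
  rw [tendstoInMeasure_iff_dist] at hT
  refine tendsto_of_tendsto_of_tendsto_of_le_of_le tendsto_const_nhds (hT ε hε)
    (fun _ => zero_le) (fun m => measure_mono fun ω hω => ?_)
  simp only [Set.mem_ofPred_eq, Real.dist_eq] at hω ⊢
  exact hω.le
end

section
/- Rate of convergence of the sample-average optimal value: assume in addition that the true problem has a unique minimizer x* ∈ X (i.e. E_μ[f(x*, ξ)] < E_μ[f(x, ξ)] for all x ≠ x*) and that f(x*, ·) is square-integrable with variance σ² = Var_μ(f(x*, ξ)). Then √m (z_m* − z*) converges in distribution to the Gaussian law N(0, σ²) as m → ∞. -/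
open MeasureTheory ProbabilityTheory Filter

/-- **Rate of convergence (asymptotic normality) of the sample-average optimal value.**
If the true problem has a unique minimizer `x*` and `f(x*, ·)` is square-integrable with
variance `σ²`, then `√m (z_m* − z*)` converges in distribution to `N(0, σ²)`; convergence
in distribution is expressed by integration against bounded continuous test functions. -/
theorem saa_value_clt
    {Ω : Type*} [MeasurableSpace Ω] (P : Measure Ω) [IsProbabilityMeasure P]
    {Ξ : Type*} [MeasurableSpace Ξ] (μ : Measure Ξ) [IsProbabilityMeasure μ]
    (ξ : ℕ → Ω → Ξ)
    (hmeas : ∀ i, Measurable (ξ i))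
    (hdist : ∀ i, Measure.map (ξ i) P = μ)
    (hindep : iIndepFun ξ P)
    {X : Type*} [Fintype X] [Nonempty X]
    (f : X → Ξ → ℝ)
    (hfm : ∀ x, Measurable (f x))
    (hfi : ∀ x, Integrable (f x) μ)
    (xstar : X)
    (hunique : ∀ x : X, x ≠ xstar → ∫ ξv, f xstar ξv ∂μ < ∫ ξv, f x ξv ∂μ)
    (hL2 : MemLp (f xstar) 2 μ) :
    ∀ g : BoundedContinuousFunction ℝ ℝ,
      Tendsto
        (fun m : ℕ => ∫ ω, g (Real.sqrt m *
            ((⨅ x : X, (m : ℝ)⁻¹ * ∑ i ∈ Finset.range m, f x (ξ i ω))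
              - ⨅ x : X, ∫ ξv, f x ξv ∂μ)) ∂P)
        atTop
        (nhds (∫ y, g y ∂(gaussianReal 0 (variance (f xstar) μ).toNNReal))) := by
  intro g
  have hmp : ∀ i, MeasurePreserving (ξ i) P μ := fun i => ⟨hmeas i, hdist i⟩
  have hident : ∀ x i, IdentDistrib (fun ω => f x (ξ i ω)) (fun ω => f x (ξ 0 ω)) P P := by
    intro x i
    have h0 : IdentDistrib (ξ i) (ξ 0) P P :=
      ⟨(hmeas i).aemeasurable, (hmeas 0).aemeasurable, by rw [hdist, hdist]⟩
    exact h0.comp (hfm x)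
  have hind : ∀ x, iIndepFun (fun i ω => f x (ξ i ω)) P := fun x =>
    hindep.comp (fun _ => f x) (fun _ => hfm x)
  have hint : ∀ x, ∫ ω, f x (ξ 0 ω) ∂P = ∫ v, f x v ∂μ := by
    intro x
    rw [← hdist 0, integral_map (hmeas 0).aemeasurable (hfm x).aestronglyMeasurable]
  have hvar : variance (fun ω => f xstar (ξ 0 ω)) P = variance (f xstar) μ := by
    rw [← hdist 0, variance_map (hfm xstar).aemeasurable (hmeas 0).aemeasurable]
    rfl
  have hmin : ⨅ x : X, ∫ v, f x v ∂μ = ∫ v, f xstar v ∂μ := by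
    apply le_antisymm (ciInf_le (Set.finite_range _).bddBelow xstar)
    apply le_ciInf
    intro x
    by_cases hx : x = xstar
    · rw [hx]
    · exact (hunique x hx).le
  have hslln : ∀ᵐ ω ∂P, ∀ x, Tendsto
      (fun m : ℕ => (m : ℝ)⁻¹ * ∑ i ∈ Finset.range m, f x (ξ i ω)) atTop
      (nhds (∫ v, f x v ∂μ)) := by
    rw [ae_all_iff]
    intro x
    have h := strong_law_ae (μ := P) (fun i ω => f x (ξ i ω))
      ((hmp 0).integrable_comp_of_integrable (hfi x))
      (fun i j hij => (hind x).indepFun hij) (hident x)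
    rw [hint x] at h
    simpa using h
  have hev : ∀ᵐ ω ∂P, ∀ᶠ m : ℕ in atTop,
      (⨅ x : X, (m : ℝ)⁻¹ * ∑ i ∈ Finset.range m, f x (ξ i ω)) =
        (m : ℝ)⁻¹ * ∑ i ∈ Finset.range m, f xstar (ξ i ω) := by
    filter_upwards [hslln] with ω hω
    have h1 : ∀ᶠ m : ℕ in atTop, ∀ x, (m : ℝ)⁻¹ * ∑ i ∈ Finset.range m, f xstar (ξ i ω)
        ≤ (m : ℝ)⁻¹ * ∑ i ∈ Finset.range m, f x (ξ i ω) := by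
      rw [eventually_all]
      intro x
      by_cases hx : x = xstar
      · simp [hx]
      · filter_upwards [(hω xstar).eventually_lt (hω x) (hunique x hx)] with m hm using hm.le
    filter_upwards [h1] with m hm
    exact le_antisymm (ciInf_le (Set.finite_range _).bddBelow xstar) (le_ciInf hm)
  have hclt := tendstoInDistribution_inv_sqrt_mul_sum_sub (P := P)
    (X := fun i ω => f xstar (ξ i ω)) (Y := id)
    (P' := gaussianReal 0 (variance (f xstar) μ).toNNReal)
    (by rw [hvar]; exact HasLaw.id)
    (hL2.comp_measurePreserving (hmp 0)) (hind xstar) (hident xstar)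
  have hYm : ∀ m : ℕ, Measurable (fun ω => Real.sqrt m *
            ((⨅ x : X, (m : ℝ)⁻¹ * ∑ i ∈ Finset.range m, f x (ξ i ω))
              - ⨅ x : X, ∫ ξv, f x ξv ∂μ)) := by
    intro m
    refine Measurable.const_mul (Measurable.sub_const (Measurable.iInf fun x => ?_) _) _
    exact (Finset.measurable_fun_sum _ fun i _ => (hfm x).comp (hmeas i)).const_mul _
  have hD := tendstoInDistribution_of_tendstoInMeasure_sub
    (fun (m : ℕ) ω => Real.sqrt m *
            ((⨅ x : X, (m : ℝ)⁻¹ * ∑ i ∈ Finset.range m, f x (ξ i ω))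
              - ⨅ x : X, ∫ ξv, f x ξv ∂μ)) _ hclt ?_ (fun m => (hYm m).aemeasurable)
  · have h2 := (ProbabilityMeasure.tendsto_iff_forall_integral_tendsto.1 hD.tendsto) g
    simp only [ProbabilityMeasure.coe_mk, Measure.map_id] at h2
    refine h2.congr fun m => ?_
    exact integral_map (hYm m).aemeasurable g.continuous.aestronglyMeasurable
  · apply tendstoInMeasure_of_tendsto_ae
    · intro m
      exact ((hYm m).aemeasurable.sub (hclt.forall_aemeasurable m)).aestronglyMeasurable
    · filter_upwards [hev] with ω hω
      refine tendsto_const_nhds.congr' ?_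
      filter_upwards [hω, eventually_gt_atTop 0] with m hm hm0
      have hs : (0 : ℝ) < Real.sqrt m := Real.sqrt_pos.2 (by exact_mod_cast hm0)
      have hs2 : (m : ℝ) = Real.sqrt m * Real.sqrt m := (Real.mul_self_sqrt (by positivity)).symm
      simp only [Pi.sub_apply, Pi.zero_apply]
      rw [hm, hmin, hint]
      generalize Real.sqrt m = s at *
      rw [hs2]
      field_simp
      ring
end

section
/- Monotonicity of the mask: if q_k ≥ 0 for all k and both F(i) and F(i+1) are nonempty for some 1 ≤ i ≤ n−1, then mask(i) ≤ mask(i+1). -/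
/-- **Monotonicity of the mask.**
With nonnegative demands, if the feasible split sets `F(i)` and `F(i+1)` are both nonempty
for some `1 ≤ i ≤ n−1`, then `mask(i) ≤ mask(i+1)`, where `mask(j) = min F(j)` and
`F(j) = {p : p ≤ j−1, ∑_{k=p+1}^j q_k ≤ Q}`. -/
theorem mask_monotone
    (n : ℕ) (hn : 1 ≤ n) (Q : ℝ) (hQ : 0 ≤ Q)
    (q : ℕ → ℝ) (hq : ∀ k, 1 ≤ k → k ≤ n → 0 ≤ q k) :
    ∀ i : ℕ, 1 ≤ i → i ≤ n - 1 →
      ({p : ℕ | p ≤ i - 1 ∧ ∑ k ∈ Finset.Icc (p + 1) i, q k ≤ Q}).Nonempty →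
      ({p : ℕ | p ≤ (i + 1) - 1 ∧ ∑ k ∈ Finset.Icc (p + 1) (i + 1), q k ≤ Q}).Nonempty →
      sInf {p : ℕ | p ≤ i - 1 ∧ ∑ k ∈ Finset.Icc (p + 1) i, q k ≤ Q}
        ≤ sInf {p : ℕ | p ≤ (i + 1) - 1 ∧ ∑ k ∈ Finset.Icc (p + 1) (i + 1), q k ≤ Q} := by
  intro i hi hin h1 h2
  obtain ⟨hm, hs⟩ := Nat.sInf_mem h2
  generalize sInf {p : ℕ | p ≤ (i + 1) - 1 ∧ ∑ k ∈ Finset.Icc (p + 1) (i + 1), q k ≤ Q} = m at *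
  by_cases hmi : m ≤ i - 1
  · apply Nat.sInf_le
    refine ⟨hmi, ?_⟩
    rw [Finset.sum_Icc_succ_top (by omega)] at hs
    have := hq (i + 1) (by omega) (by omega)
    linarith
  · obtain ⟨ha, -⟩ := Nat.sInf_mem h1
    omega
end

section
/- Correctness of the split dynamic program: suppose q_k ≥ 0 and q_k ≤ Q for all 1 ≤ k ≤ n, and define f : {0, …, n} → ℝ by f(0) = 0 and f(i) = min_{p ∈ F(i)} { f(p) + segCost(p, i) } for 1 ≤ i ≤ n. Then for each 1 ≤ i ≤ n, f(i) equals the minimum, over all feasible splits of the prefix (σ_1, …, σ_i) — that is, over all finite strictly increasing sequences 0 = p_0 < p_1 < ⋯ < p_r = i such that ∑_{k=p_{j−1}+1}^{p_j} q_k ≤ Q for every 1 ≤ j ≤ r — of the total routing cost ∑_{j=1}^{r} segCost(p_{j−1}, p_j). -/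
/-- The cost of serving the consecutive segment of customers `σ_{p+1}, …, σ_i` by a single
vehicle: depot to first customer, along the tour, and back to the return depot `n+1`. -/
noncomputable def segCost (n : ℕ) (σ : ℕ → ℕ) (c : ℕ → ℕ → ℝ) (p i : ℕ) : ℝ :=
  c 0 (σ (p + 1)) + ∑ k ∈ Finset.Ico (p + 1) i, c (σ k) (σ (k + 1)) + c (σ i) (n + 1)

/-- **Correctness of the split dynamic program.**
If `0 ≤ q_k ≤ Q` for all `1 ≤ k ≤ n` and `f` satisfies the DP recursion
`f(0) = 0`, `f(i) = min_{p ∈ F(i)} (f(p) + segCost(p, i))`, then for each `1 ≤ i ≤ n`,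
`f(i)` is the minimum total routing cost over all feasible splits
`0 = p_0 < p_1 < ⋯ < p_r = i` of the prefix `(σ_1, …, σ_i)`, where every block satisfies
the capacity constraint `∑_{k=p_{j-1}+1}^{p_j} q_k ≤ Q`. -/
theorem split_dp_correct
    (n : ℕ) (hn : 1 ≤ n)
    (σ : ℕ → ℕ) (hσ0 : σ 0 = 0) (hσlast : σ (n + 1) = n + 1)
    (c : ℕ → ℕ → ℝ)
    (Q : ℝ) (hQ : 0 ≤ Q)
    (q : ℕ → ℝ)
    (hq : ∀ k, 1 ≤ k → k ≤ n → 0 ≤ q k)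
    (hqQ : ∀ k, 1 ≤ k → k ≤ n → q k ≤ Q)
    (f : ℕ → ℝ)
    (hf0 : f 0 = 0)
    (hfrec : ∀ i : ℕ, 1 ≤ i → i ≤ n →
      f i = sInf ((fun p => f p + segCost n σ c p i) ''
        {p : ℕ | p ≤ i - 1 ∧ ∑ k ∈ Finset.Icc (p + 1) i, q k ≤ Q})) :
    ∀ i : ℕ, 1 ≤ i → i ≤ n →
      f i = sInf {cost : ℝ | ∃ (r : ℕ) (ps : ℕ → ℕ),
        1 ≤ r ∧ ps 0 = 0 ∧ ps r = i ∧
        (∀ j < r, ps j < ps (j + 1)) ∧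
        (∀ j < r, ∑ k ∈ Finset.Icc (ps j + 1) (ps (j + 1)), q k ≤ Q) ∧
        cost = ∑ j ∈ Finset.range r, segCost n σ c (ps j) (ps (j + 1))} := by
  classical
  have hfin : ∀ i : ℕ, ((fun p => f p + segCost n σ c p i) ''
        {p : ℕ | p ≤ i - 1 ∧ ∑ k ∈ Finset.Icc (p + 1) i, q k ≤ Q}).Finite := fun i =>
    ((Set.finite_Iic (i - 1)).subset (fun p hp => hp.1)).image _
  have hle : ∀ i p : ℕ, i ≤ n → p < i → ∑ k ∈ Finset.Icc (p + 1) i, q k ≤ Q →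
      f i ≤ f p + segCost n σ c p i := by
    intro i p hi hp hs
    rw [hfrec i (by omega) hi]
    exact csInf_le (hfin i).bddBelow ⟨p, ⟨by omega, hs⟩, rfl⟩
  have hex : ∀ i : ℕ, 1 ≤ i → i ≤ n → ∃ p, p < i ∧ ∑ k ∈ Finset.Icc (p + 1) i, q k ≤ Q ∧
      f i = f p + segCost n σ c p i := by
    intro i h1 hi
    have hne : ((fun p => f p + segCost n σ c p i) ''
        {p : ℕ | p ≤ i - 1 ∧ ∑ k ∈ Finset.Icc (p + 1) i, q k ≤ Q}).Nonempty := by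
      refine ⟨_, i - 1, ⟨le_refl _, ?_⟩, rfl⟩
      rw [Nat.sub_add_cancel h1]
      simpa using hqQ i h1 hi
    have hm := hne.csInf_mem (hfin i)
    rw [← hfrec i h1 hi] at hm
    obtain ⟨p, ⟨hp, hs⟩, he⟩ := hm
    exact ⟨p, by omega, hs, he.symm⟩
  have hlow : ∀ (r : ℕ) (ps : ℕ → ℕ), ps 0 = 0 → ps r ≤ n →
      (∀ j < r, ps j < ps (j + 1)) →
      (∀ j < r, ∑ k ∈ Finset.Icc (ps j + 1) (ps (j + 1)), q k ≤ Q) →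
      f (ps r) ≤ ∑ j ∈ Finset.range r, segCost n σ c (ps j) (ps (j + 1)) := by
    intro r ps h0
    induction r with
    | zero => intro _ _ _; simp [h0, hf0]
    | succ r ih =>
      intro hn' hlt hs
      have hl := hlt r (by omega)
      have h1 := ih (by omega) (fun j hj => hlt j (by omega)) (fun j hj => hs j (by omega))
      have h2 := hle _ _ hn' hl (hs r (by omega))
      rw [Finset.sum_range_succ]
      linarith
  have hatt : ∀ i : ℕ, i ≤ n → ∃ (r : ℕ) (ps : ℕ → ℕ), ps 0 = 0 ∧ ps r = i ∧
        (∀ j < r, ps j < ps (j + 1)) ∧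
        (∀ j < r, ∑ k ∈ Finset.Icc (ps j + 1) (ps (j + 1)), q k ≤ Q) ∧
        f i = ∑ j ∈ Finset.range r, segCost n σ c (ps j) (ps (j + 1)) := by
    intro i
    induction i using Nat.strong_induction_on with
    | _ i ih =>
      intro hi
      rcases Nat.eq_zero_or_pos i with rfl | hpos
      · exact ⟨0, fun _ => 0, rfl, rfl, by simp, by simp, by simp [hf0]⟩
      obtain ⟨p, hp, hs, he⟩ := hex i hpos hi
      obtain ⟨r, ps, h0, hr, hlt, hss, hc⟩ := ih p hp (by omega)
      have e1 : ∀ j, j ≤ r → (fun j => if j ≤ r then ps j else i) j = ps j :=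
        fun j hj => if_pos hj
      have e2 : (fun j => if j ≤ r then ps j else i) (r + 1) = i := if_neg (by omega)
      generalize (fun j => if j ≤ r then ps j else i) = ps' at e1 e2
      refine ⟨r + 1, ps', by rw [e1 0 (by omega), h0], e2, ?_, ?_, ?_⟩
      · intro j hj
        rcases Nat.lt_succ_iff_lt_or_eq.mp hj with h | rfl
        · rw [e1 j (by omega), e1 (j + 1) (by omega)]; exact hlt j h
        · rw [e1 j le_rfl, e2, hr]; exact hp
      · intro j hj
        rcases Nat.lt_succ_iff_lt_or_eq.mp hj with h | rfl
        · rw [e1 j (by omega), e1 (j + 1) (by omega)]; exact hss j h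
        · rw [e1 j le_rfl, e2, hr]; exact hs
      · rw [Finset.sum_range_succ, e1 r le_rfl, e2, hr, he, hc]
        congr 1
        refine Finset.sum_congr rfl fun j hj => ?_
        have := Finset.mem_range.mp hj
        rw [e1 j (by omega), e1 (j + 1) (by omega)]
  intro i h1 hi
  symm
  apply IsLeast.csInf_eq
  constructor
  · obtain ⟨r, ps, h0, hr, hlt, hs, hc⟩ := hatt i hi
    refine ⟨r, ps, ?_, h0, hr, hlt, hs, hc⟩
    rcases Nat.eq_zero_or_pos r with rfl | h
    · omega
    · exact h
  · rintro _ ⟨r, ps, _, h0, rfl, hlt, hs, rfl⟩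
    exact hlow r ps h0 hi hlt hs
end
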